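/- For the crowd-motion feasible set Q := {q ∈ ℝ^{2N} : D_ij(q) ≥ 0 for all i ≠ j}, where D_ij(q) = |q_i − q_j| − 2r, the negative polar cone N_q := C_q° = {w ∈ ℝ^{2N} : w·v ≤ 0 for all v ∈ C_q} of the cone of feasible velocities C_q = {v ∈ ℝ^{2N} : for all i < j, D_ij(q) = 0 ⟹ G_ij(q)·v ≥ 0} equals the proximal normal cone N(Q,q), and moreover N_q = N(Q,q) = { −Σ λ_ij G_ij(q) : λ_ij ≥ 0, and D_ij(q) > 0 ⟹ λ_ij = 0 }. -/

import Mathlib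

open MeasureTheory Set Filter Topology

noncomputable section

/-- The (set-valued) metric projection onto `C`:
`P_C(y) = {z ∈ C | ‖y - z‖ = d(y,C)}`. -/
def projSet {E : Type*} [NormedAddCommGroup E] (C : Set E) (y : E) : Set E :=
  {z | z ∈ C ∧ ‖y - z‖ = Metric.infDist y C}

/-- The proximal normal cone of `C` at `x`:
`N(C,x) = {v | ∃ s > 0, x ∈ P_C(x + s v)}`. -/
def proxNormalCone {E : Type*} [NormedAddCommGroup E] [NormedSpace ℝ E]
    (C : Set E) (x : E) : Set E :=
  {v | ∃ s : ℝ, 0 < s ∧ x ∈ projSet C (x + s • v)}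

open scoped RealInnerProductSpace

/-- The configuration space `ℝ^{2N}` of `N` disks in the plane, with its Euclidean
(Hilbert) structure. -/
abbrev Conf (N : ℕ) := PiLp 2 fun _ : Fin N => EuclideanSpace ℝ (Fin 2)

/-- `D_{ij}(q) = |q_i - q_j| - 2r`, the signed distance between disks `i` and `j`. -/
def Dij {N : ℕ} (r : ℝ) (q : Conf N) (i j : Fin N) : ℝ := ‖q i - q j‖ - 2 * r

/-- `e_{ij}(q) = (q_j - q_i)/|q_j - q_i|`. -/
def eij {N : ℕ} (q : Conf N) (i j : Fin N) : EuclideanSpace ℝ (Fin 2) :=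
  ‖q j - q i‖⁻¹ • (q j - q i)

/-- The gradient `G_{ij}(q) = ∇D_{ij}(q) ∈ ℝ^{2N}`: the vector whose `i`-th block is
`-e_{ij}(q)`, whose `j`-th block is `e_{ij}(q)`, and whose other blocks vanish. -/
def Gij {N : ℕ} (q : Conf N) (i j : Fin N) : Conf N :=
  (WithLp.equiv 2 (∀ _ : Fin N, EuclideanSpace ℝ (Fin 2))).symm
    fun k => if k = i then -eij q i j else if k = j then eij q i j else 0

/-- The set of feasible configurations `Q = {q | D_{ij}(q) ≥ 0 ∀ i ≠ j}`. -/
def Qset (N : ℕ) (r : ℝ) : Set (Conf N) :=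
  {q | ∀ i j : Fin N, i ≠ j → 0 ≤ Dij r q i j}

/-- The cone of feasible velocities `C_q`. -/
def Cq {N : ℕ} (r : ℝ) (q : Conf N) : Set (Conf N) :=
  {v | ∀ i j : Fin N, i < j → Dij r q i j = 0 → 0 ≤ ⟪Gij q i j, v⟫}

/-- The negative polar cone `N_q = C_q°`. -/
def Nq {N : ℕ} (r : ℝ) (q : Conf N) : Set (Conf N) :=
  {w | ∀ v ∈ Cq r q, ⟪w, v⟫ ≤ 0}

section Farkas

variable {E ι : Type*} [NormedAddCommGroup E] [InnerProductSpace ℝ E]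

/-- **Farkas' lemma** for finitely many vectors of a real inner product space. -/
theorem exists_nonneg_eq_sum_smul_of_forall_inner_nonneg (s : Finset ι) (a : ι → E) (b : E)
    (h : ∀ x, (∀ i ∈ s, 0 ≤ ⟪a i, x⟫) → 0 ≤ ⟪b, x⟫) :
    ∃ c : ι → ℝ, (∀ i, 0 ≤ c i) ∧ b = ∑ i ∈ s, c i • a i := by
  classical
  induction s using Finset.induction_on generalizing a b with
  | empty =>
    refine ⟨0, fun _ => le_rfl, ?_⟩
    have hb := h (-b) (by simp)
    rw [inner_neg_right, real_inner_self_eq_norm_sq] at hb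
    simpa using (by nlinarith [norm_nonneg b] : ‖b‖ = 0)
  | insert k s hk ih =>
    by_cases hs : ∀ x, (∀ i ∈ s, 0 ≤ ⟪a i, x⟫) → 0 ≤ ⟪b, x⟫
    · obtain ⟨c, hc, rfl⟩ := ih a b hs
      refine ⟨fun i => if i = k then 0 else c i, fun i => ?_, ?_⟩
      · dsimp only
        split_ifs
        exacts [le_rfl, hc i]
      · dsimp only
        rw [Finset.sum_insert hk, if_pos rfl, zero_smul, zero_add]
        refine Finset.sum_congr rfl fun i hi => ?_
        rw [if_neg (ne_of_mem_of_not_mem hi hk)]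
    · push Not at hs
      obtain ⟨y, hy, hby⟩ := hs
      have hky : ⟪a k, y⟫ < 0 := by
        by_contra! hky
        exact hby.not_ge (h y (by simpa [hky] using hy))
      obtain ⟨z, hz, hbz, hkz⟩ : ∃ z, (∀ i ∈ s, 0 ≤ ⟪a i, z⟫) ∧ ⟪b, z⟫ < 0 ∧ ⟪a k, z⟫ = -1 := by
        have ht : 0 < (-⟪a k, y⟫)⁻¹ := inv_pos.2 (neg_pos.2 hky)
        refine ⟨(-⟪a k, y⟫)⁻¹ • y, fun i hi => ?_, ?_, ?_⟩
        · rw [real_inner_smul_right]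
          exact mul_nonneg ht.le (hy i hi)
        · rw [real_inner_smul_right]
          exact mul_neg_of_pos_of_neg ht hby
        · rw [real_inner_smul_right]
          field_simp [hky.ne]
      have key (u x : E) : ⟪u + ⟪u, z⟫ • a k, x⟫ = ⟪u, x + ⟪a k, x⟫ • z⟫ := by
        simp only [inner_add_left, inner_add_right, real_inner_smul_left, real_inner_smul_right]
        ring
      obtain ⟨c, hc, hb⟩ := ih (fun i => a i + ⟪a i, z⟫ • a k) (b + ⟪b, z⟫ • a k) fun x hx => by
        rw [key]
        refine h _ fun i hi => ?_
        rcases Finset.mem_insert.1 hi with rfl | hi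
        · rw [inner_add_right, real_inner_smul_right, hkz]
          linarith
        · rw [← key]
          exact hx i hi
      have hnn : 0 ≤ ∑ i ∈ s, c i * ⟪a i, z⟫ :=
        Finset.sum_nonneg fun i hi => mul_nonneg (hc i) (hz i hi)
      refine ⟨fun i => if i = k then ∑ i ∈ s, c i * ⟪a i, z⟫ - ⟪b, z⟫ else c i, fun i => ?_, ?_⟩
      · dsimp only
        split_ifs
        exacts [by linarith, hc i]
      · dsimp only
        rw [Finset.sum_insert hk, if_pos rfl]
        simp only [smul_add, Finset.sum_add_distrib, smul_smul, ← Finset.sum_smul] at hb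
        have hcongr (t : ℝ) : ∑ i ∈ s, (if i = k then t else c i) • a i = ∑ i ∈ s, c i • a i :=
          Finset.sum_congr rfl fun i hi => by rw [if_neg (ne_of_mem_of_not_mem hi hk)]
        rw [hcongr]
        exact (eq_sub_of_add_eq hb).trans (by module)

end Farkas

section ProximalNormal

variable {E : Type*} [NormedAddCommGroup E] [InnerProductSpace ℝ E]

/-- The quadratic characterization of proximal normals. -/
theorem mem_proxNormalCone_iff {C : Set E} {x v : E} (hx : x ∈ C) :
    v ∈ proxNormalCone C x ↔ ∃ s : ℝ, 0 < s ∧ ∀ z ∈ C, 2 * s * ⟪v, z - x⟫ ≤ ‖z - x‖ ^ 2 := by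
  have expand (s : ℝ) (z : E) : ‖x + s • v - z‖ ^ 2 =
      ‖x + s • v - x‖ ^ 2 - 2 * s * ⟪v, z - x⟫ + ‖z - x‖ ^ 2 := by
    rw [show x + s • v - z = s • v - (z - x) by abel, norm_sub_sq_real, real_inner_smul_left,
      add_sub_cancel_left]
    ring
  refine exists_congr fun s => and_congr_right fun _ => ⟨fun ⟨_, h⟩ z hz => ?_, fun h => ⟨hx, ?_⟩⟩
  · have hle : ‖x + s • v - x‖ ≤ ‖x + s • v - z‖ := by
      rw [h, ← dist_eq_norm]
      exact Metric.infDist_le_dist_of_mem hz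
    have := pow_le_pow_left₀ (norm_nonneg _) hle 2
    linarith [expand s z]
  · refine le_antisymm ((Metric.le_infDist ⟨x, hx⟩).2 fun z hz => ?_) ?_
    · rw [dist_eq_norm]
      refine le_of_sq_le_sq ?_ (norm_nonneg _)
      linarith [expand s z, h z hz]
    · rw [← dist_eq_norm]
      exact Metric.infDist_le_dist_of_mem hx

/-- The norm lies above its tangent at `a`. -/
theorem norm_add_inner_le_norm_add (a h : E) : ‖a‖ + ⟪‖a‖⁻¹ • a, h⟫ ≤ ‖a + h‖ := by
  rcases eq_or_ne a 0 with rfl | ha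
  · simp
  · have hpos := norm_pos_iff.2 ha
    have hcs := real_inner_le_norm a (a + h)
    rw [inner_add_right, real_inner_self_eq_norm_sq] at hcs
    rw [real_inner_smul_left, ← mul_le_mul_iff_right₀ hpos]
    field_simp
    linarith

/-- The norm exceeds its tangent at `a` by at most a quadratic term. -/
theorem norm_add_le_norm_add_inner {a : E} (ha : a ≠ 0) (h : E) :
    ‖a + h‖ ≤ ‖a‖ + ⟪‖a‖⁻¹ • a, h⟫ + ‖h‖ ^ 2 / (2 * ‖a‖) := by
  have hpos := norm_pos_iff.2 ha
  have hsq := norm_add_sq_real a h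
  rw [real_inner_smul_left, ← mul_le_mul_iff_right₀ (by positivity : 0 < 2 * ‖a‖)]
  field_simp
  linarith [sq_nonneg (‖a + h‖ - ‖a‖)]

end ProximalNormal

section CrowdMotion

variable {N : ℕ} {r : ℝ} {q : Conf N}

theorem Dij_comm (r : ℝ) (q : Conf N) (i j : Fin N) : Dij r q i j = Dij r q j i := by
  rw [Dij, Dij, norm_sub_rev]

theorem inner_Gij (q v : Conf N) {i j : Fin N} (hij : i ≠ j) :
    ⟪Gij q i j, v⟫ = ⟪eij q i j, v j - v i⟫ := by
  have hterm (k : Fin N) : ⟪Gij q i j k, v k⟫ =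
      (if k = i then -⟪eij q i j, v i⟫ else 0) + (if k = j then ⟪eij q i j, v j⟫ else 0) := by
    change ⟪if k = i then -eij q i j else if k = j then eij q i j else 0, v k⟫ = _
    by_cases hi : k = i
    · subst hi
      simp [hij]
    · by_cases hj : k = j
      · subst hj
        simp [hi]
      · simp [hi, hj]
  rw [PiLp.inner_apply, Finset.sum_congr rfl fun k _ => hterm k, Finset.sum_add_distrib,
    inner_sub_right]
  simp
  ring

theorem Dij_add_inner_le (r : ℝ) (q v : Conf N) {i j : Fin N} (hij : i ≠ j) :
    Dij r q i j + ⟪Gij q i j, v⟫ ≤ Dij r (q + v) i j := by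
  have h := norm_add_inner_le_norm_add (q j - q i) (v j - v i)
  rw [inner_Gij q v hij, Dij_comm r q, Dij_comm r (q + v), Dij, Dij, PiLp.add_apply,
    PiLp.add_apply, add_sub_add_comm, eij]
  linarith

theorem Dij_le_add_inner (hr : 0 < r) (v : Conf N) {i j : Fin N} (hij : i ≠ j)
    (hD : Dij r q i j = 0) :
    Dij r (q + v) i j ≤ ⟪Gij q i j, v⟫ + ‖v‖ ^ 2 / r := by
  rw [Dij_comm, Dij, sub_eq_zero] at hD
  have hne : q j - q i ≠ 0 := norm_pos_iff.1 (by linarith)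
  have h := norm_add_le_norm_add_inner hne (v j - v i)
  have hv : ‖v j - v i‖ ≤ 2 * ‖v‖ := by
    linarith [norm_sub_le (v j) (v i), PiLp.norm_apply_le v i, PiLp.norm_apply_le v j]
  have hquad : ‖v j - v i‖ ^ 2 / (2 * (2 * r)) ≤ ‖v‖ ^ 2 / r := by
    rw [div_le_div_iff₀ (by positivity) hr]
    nlinarith [pow_le_pow_left₀ (norm_nonneg _) hv 2]
  rw [inner_Gij q v hij, Dij_comm, Dij, PiLp.add_apply, PiLp.add_apply, add_sub_add_comm, eij]
  rw [hD] at h ⊢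
  linarith

theorem continuous_Dij (r : ℝ) (i j : Fin N) : Continuous fun q : Conf N => Dij r q i j := by
  unfold Dij
  fun_prop

/-- A feasible velocity can be followed for a short time inside the feasible set. -/
theorem eventually_add_smul_mem_Qset (hq : q ∈ Qset N r) {v : Conf N} (hv : v ∈ Cq r q) :
    ∀ᶠ t : ℝ in 𝓝[>] 0, q + t • v ∈ Qset N r := by
  have hlt (i j : Fin N) (hij : i < j) : ∀ᶠ t : ℝ in 𝓝[>] 0, 0 ≤ Dij r (q + t • v) i j := by
    rcases (hq i j hij.ne).eq_or_lt with h0 | hpos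
    · filter_upwards [self_mem_nhdsWithin] with t (ht : 0 < t)
      refine le_trans ?_ (Dij_add_inner_le r q (t • v) hij.ne)
      rw [← h0, zero_add, real_inner_smul_right]
      exact mul_nonneg ht.le (hv i j hij h0.symm)
    · have hcont : Continuous fun t : ℝ => Dij r (q + t • v) i j :=
        (continuous_Dij r i j).comp (by fun_prop)
      have h0 : 0 < Dij r (q + (0 : ℝ) • v) i j := by rwa [zero_smul, add_zero]
      have hev := (hcont.tendsto 0).eventually_const_lt h0
      exact (hev.filter_mono nhdsWithin_le_nhds).mono fun _ => le_of_lt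
  simp only [Qset, mem_ofPred_eq, eventually_all]
  intro i j hij
  rcases hij.lt_or_gt with h | h
  · exact hlt i j h
  · simpa only [Dij_comm r _ i j] using hlt j i h

theorem proxNormalCone_Qset_subset_Nq (hq : q ∈ Qset N r) :
    proxNormalCone (Qset N r) q ⊆ Nq r q := by
  intro w hw v hv
  obtain ⟨s, hs, h⟩ := (mem_proxNormalCone_iff hq).1 hw
  have hev : ∀ᶠ t : ℝ in 𝓝[>] 0, 2 * s * ⟪w, v⟫ ≤ t * ‖v‖ ^ 2 := by
    filter_upwards [eventually_add_smul_mem_Qset hq hv, self_mem_nhdsWithin] with t ht (ht0 : 0 < t)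
    have := h _ ht
    rw [add_sub_cancel_left, real_inner_smul_right, norm_smul, mul_pow, Real.norm_eq_abs,
      sq_abs] at this
    nlinarith
  have hlim : Tendsto (fun t : ℝ => t * ‖v‖ ^ 2) (𝓝[>] 0) (𝓝 0) := by
    have hcont : Continuous fun t : ℝ => t * ‖v‖ ^ 2 := by fun_prop
    simpa using (hcont.tendsto 0).mono_left nhdsWithin_le_nhds
  nlinarith [ge_of_tendsto hlim hev]

/-- The cone generated by the outward normals `-G_{ij}(q)` of the active constraints. -/
def activeNormalCone (r : ℝ) (q : Conf N) : Set (Conf N) :=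
  {w | ∃ lam : Fin N → Fin N → ℝ,
    (∀ i j, 0 ≤ lam i j) ∧
    (∀ i j, 0 < Dij r q i j → lam i j = 0) ∧
    w = -∑ i : Fin N, ∑ j : Fin N, if i < j then lam i j • Gij q i j else 0}

theorem Nq_subset_activeNormalCone (r : ℝ) (q : Conf N) : Nq r q ⊆ activeNormalCone r q := by
  classical
  intro w hw
  let s : Finset (Fin N × Fin N) := {p | p.1 < p.2 ∧ Dij r q p.1 p.2 = 0}
  obtain ⟨c, hc, hsum⟩ := exists_nonneg_eq_sum_smul_of_forall_inner_nonneg s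
    (fun p => Gij q p.1 p.2) (-w) fun x hx => by
      have := hw x fun i j hij hD => hx (i, j) (by simp [s, hij, hD])
      rw [inner_neg_left]
      linarith
  refine ⟨fun i j => if Dij r q i j = 0 then c (i, j) else 0, fun i j => ?_, fun i j hD => ?_, ?_⟩
  · dsimp only
    split_ifs
    exacts [hc _, le_rfl]
  · exact if_neg hD.ne'
  · rw [← neg_eq_iff_eq_neg, hsum, Finset.sum_filter, ← Finset.univ_product_univ,
      Finset.sum_product]
    refine Finset.sum_congr rfl fun i _ => Finset.sum_congr rfl fun j _ => ?_
    by_cases hij : i < j <;> by_cases hD : Dij r q i j = 0 <;> simp [hij, hD]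

theorem activeNormalCone_subset_proxNormalCone (hr : 0 < r) (hq : q ∈ Qset N r) :
    activeNormalCone r q ⊆ proxNormalCone (Qset N r) q := by
  rintro _ ⟨lam, hlam, hcompl, rfl⟩
  have hS : 0 ≤ ∑ i, ∑ j, lam i j :=
    Finset.sum_nonneg fun i _ => Finset.sum_nonneg fun j _ => hlam i j
  refine (mem_proxNormalCone_iff hq).2
    ⟨r / (2 * (∑ i, ∑ j, lam i j + 1)), by positivity, fun z hz => ?_⟩
  have hterm (i j : Fin N) :
      -⟪if i < j then lam i j • Gij q i j else 0, z - q⟫ ≤ lam i j * (‖z - q‖ ^ 2 / r) := by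
    have hnn : 0 ≤ lam i j * (‖z - q‖ ^ 2 / r) := mul_nonneg (hlam i j) (by positivity)
    split_ifs with hij
    · rcases (hq i j hij.ne).eq_or_lt with h0 | hpos
      · have hD := Dij_le_add_inner hr (z - q) hij.ne h0.symm
        rw [add_sub_cancel] at hD
        rw [real_inner_smul_left]
        nlinarith [hlam i j, hz i j hij.ne]
      · simp [hcompl i j hpos]
    · simpa using hnn
  have hbound : ⟪-∑ i, ∑ j, if i < j then lam i j • Gij q i j else 0, z - q⟫ ≤
      (∑ i, ∑ j, lam i j) * (‖z - q‖ ^ 2 / r) := by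
    simp only [inner_neg_left, sum_inner, ← Finset.sum_neg_distrib, Finset.sum_mul]
    exact Finset.sum_le_sum fun i _ => Finset.sum_le_sum fun j _ => hterm i j
  generalize ∑ i, ∑ j, lam i j = S at *
  calc _ ≤ 2 * (r / (2 * (S + 1))) * (S * (‖z - q‖ ^ 2 / r)) := by gcongr
    _ = S / (S + 1) * ‖z - q‖ ^ 2 := by field_simp
    _ ≤ 1 * ‖z - q‖ ^ 2 := by
      gcongr
      exact (div_le_one (by positivity)).2 (by linarith)
    _ = _ := one_mul _

end CrowdMotion

/-- For the crowd-motion feasible set `Q`, the polar cone `N_q` of the cone of feasible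
velocities coincides with the proximal normal cone `N(Q,q)`, and both are generated by
the vectors `-G_{ij}(q)` corresponding to active constraints. -/
theorem crowd_motion_polar_cone_eq_proximal_normal_cone
    (N : ℕ) (r : ℝ) (hr : 0 < r) (q : Conf N) (hq : q ∈ Qset N r) :
    Nq r q = proxNormalCone (Qset N r) q ∧
      proxNormalCone (Qset N r) q =
        {w | ∃ lam : Fin N → Fin N → ℝ,
          (∀ i j, 0 ≤ lam i j) ∧
          (∀ i j, 0 < Dij r q i j → lam i j = 0) ∧
          w = -∑ i : Fin N, ∑ j : Fin N,
                if i < j then lam i j • Gij q i j else 0} := by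
  have hPN := proxNormalCone_Qset_subset_Nq hq
  have hNA := Nq_subset_activeNormalCone r q
  have hAP := activeNormalCone_subset_proxNormalCone hr hq
  exact ⟨(hNA.trans hAP).antisymm hPN, (hPN.trans hNA).antisymm hAP⟩
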